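/- Assume Vopěnka's Principle: for every proper class C of L_std-structures there are distinct M, N ∈ C and an L_std-elementary embedding j : M → N. Then for every proper class A there is an A-extendible cardinal. -/

import Mathlib

open FirstOrder

universe u

/-- The relations of the standard language `L_std`: one binary relation symbol `ε` and one
unary relation symbol `R`. -/
inductive LStdRel : ℕ → Type
  | eps : LStdRel 2
  | r : LStdRel 1

/-- The standard first-order language `L_std`, with one binary relation symbol `ε` and one
unary relation symbol `R`. -/
def LStd : FirstOrder.Language := ⟨fun _ => Empty, LStdRel⟩

/-- The `L_std`-structure coded by the ZFC sets `M` (the domain), `E` (a binary relation on `M`,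
coded as a set of Kuratowski pairs) and `R` (a unary relation, coded as a subset of `M`). -/
def codedStructure (M E R : ZFSet.{u}) : LStd.Structure ↥M.toSet where
  funMap := fun f _ => f.elim
  RelMap
    | .eps, x => ZFSet.pair (x 0).1 (x 1).1 ∈ E
    | .r, x => (x 0).1 ∈ R

/-- The ZFC set `S` codes an `L_std`-structure: it is a triple `⟨M, E, R⟩` with `E` a binary
relation on `M` and `R` a unary relation on `M`. -/
def IsLStdCode (S : ZFSet.{u}) : Prop :=
  ∃ M E R : ZFSet.{u}, S = M.pair (E.pair R) ∧
    (∀ p ∈ E, ∃ a ∈ M, ∃ b ∈ M, p = a.pair b) ∧ R ⊆ M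

/-- The ZFC set `S` codes an ordinal `L_std`-structure: an `L_std`-structure whose domain is a
(von Neumann) ordinal. -/
def IsOrdinalLStdCode (S : ZFSet.{u}) : Prop :=
  ∃ M E R : ZFSet.{u}, S = M.pair (E.pair R) ∧ M.IsOrdinal ∧
    (∀ p ∈ E, ∃ a ∈ M, ∃ b ∈ M, p = a.pair b) ∧ R ⊆ M

/-- There is an `L_std`-elementary embedding from the structure coded by `S` into the structure
coded by `T`. -/
def ElemEmbeddable (S T : ZFSet.{u}) : Prop :=
  ∃ M E R N E' R' : ZFSet.{u}, S = M.pair (E.pair R) ∧ T = N.pair (E'.pair R') ∧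
    letI := codedStructure M E R
    letI := codedStructure N E' R'
    Nonempty (↥M.toSet ↪ₑ[LStd] ↥N.toSet)

/-- A class of sets (i.e. a predicate on ZFC sets) is a proper class if it is not coextensive
with any set. -/
def IsProperClass (A : Set ZFSet.{u}) : Prop :=
  ¬∃ a : ZFSet.{u}, a.toSet = A

/-- Vopěnka's Principle: for every proper class `C` of `L_std`-structures there are distinct
`M ≠ N` in `C` such that there is an `L_std`-elementary embedding from `M` into `N`. -/
def VopenkaPrinciple : Prop :=
  ∀ C : Set ZFSet.{u}, IsProperClass C → (∀ x ∈ C, IsLStdCode x) →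
    ∃ M ∈ C, ∃ N ∈ C, M ≠ N ∧ ElemEmbeddable M N

/-- The structure `⟨V_η, ∈, A ∩ V_η⟩`: the domain consists of the sets of rank `< η`, with `ε`
interpreted as membership and `R` interpreted as membership in the class `A`. -/
def VStructure (η : Ordinal.{u}) (A : Set ZFSet.{u}) :
    LStd.Structure {x : ZFSet.{u} // x.rank < η} where
  funMap := fun f _ => f.elim
  RelMap
    | .eps, x => (x 0).1 ∈ (x 1).1
    | .r, x => (x 0).1 ∈ A

/-- The ZFC set `α` is a (von Neumann) cardinal: it is an ordinal and every one of its elements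
has strictly smaller cardinality. -/
def ZFIsCardinal (α : ZFSet.{u}) : Prop :=
  α.IsOrdinal ∧ ∀ β ∈ α, Cardinal.mk ↥β.toSet < Cardinal.mk ↥α.toSet

/-- For von Neumann ordinals `α`, `η`, `ζ` and a class `A`: there is an elementary embedding
`j : ⟨V_η, ∈, A ∩ V_η⟩ → ⟨V_ζ, ∈, A ∩ V_ζ⟩` with critical point `α` (i.e. `j` fixes every
ordinal `β < α` and moves `α`) such that `j α > η`. -/
def ExtWitness (A : Set ZFSet.{u}) (α η ζ : ZFSet.{u}) : Prop :=
  letI := VStructure η.rank A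
  letI := VStructure ζ.rank A
  ∃ j : {x : ZFSet.{u} // x.rank < η.rank} ↪ₑ[LStd] {x : ZFSet.{u} // x.rank < ζ.rank},
    (∀ (β : ZFSet.{u}) (hβ : β.rank < η.rank), β ∈ α → (j ⟨β, hβ⟩).1 = β) ∧
    ∀ hα : α.rank < η.rank, (j ⟨α, hα⟩).1 ≠ α ∧ η ∈ (j ⟨α, hα⟩).1

/-- `α` is `η`-extendible for the class `A`: there are an ordinal `ζ` and an elementary
embedding `j : ⟨V_η, ∈, A ∩ V_η⟩ → ⟨V_ζ, ∈, A ∩ V_ζ⟩` with critical point `α` and `j α > η`. -/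
def EtaExtendibleFor (A : Set ZFSet.{u}) (α η : ZFSet.{u}) : Prop :=
  ∃ ζ : ZFSet.{u}, ζ.IsOrdinal ∧ ExtWitness A α η ζ

/-- `α` is an `A`-extendible cardinal: `α` is a cardinal that is `η`-extendible for `A`
for every ordinal `η > α`. -/
def AExtendible (A : Set ZFSet.{u}) (α : ZFSet.{u}) : Prop :=
  ZFIsCardinal α ∧ ∀ η : ZFSet.{u}, η.IsOrdinal → α ∈ η → EtaExtendibleFor A α η

namespace Vopenka

open FirstOrder.Language ZFSet Order

section OrdinalEmbedding

/-- `x` is an element of `D` above `μ`, and no element of `D` below `θ` and above `μ` is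
smaller. -/
def LeastAbove (D : Set Ordinal.{u}) (θ μ x : Ordinal.{u}) : Prop :=
  x ∈ D ∧ μ < x ∧ ∀ y < θ, y ∈ D → μ < y → ¬y < x

theorem not_finite_of_forall_exists_lt {D : Set Ordinal.{u}} {l : Ordinal.{u}} (hl : 0 < l)
    (hD : ∀ μ < l, ∃ x ∈ D, μ < x ∧ x < l) : ¬(D ∩ Set.Iio l).Finite := by
  intro hfin
  obtain ⟨x, hx, -, hxl⟩ := hD 0 hl
  obtain ⟨m, hm⟩ := hfin.exists_maximal ⟨x, hx, hxl⟩
  obtain ⟨y, hy, hmy, hyl⟩ := hD m hm.prop.2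
  exact absurd (hm.le_of_ge ⟨hy, hyl⟩ hmy.le) (not_le.2 hmy)

variable {θ θ' : Ordinal.{u}} {J : Ordinal.{u} → Ordinal.{u}}

theorem le_apply_of_strictMono_below (hJ : ∀ a b, a < b → b < θ → J a < J b) {x : Ordinal.{u}}
    (hx : x < θ) : x ≤ J x := by
  induction x using WellFoundedLT.induction with
  | ind x ih =>
    by_contra! h
    exact (ih _ h (h.trans hx)).not_gt (hJ _ _ h hx)

theorem apply_eq_of_leastAbove (hJθ : ∀ a < θ, J a < θ') {D : Set Ordinal.{u}}
    {μ x : Ordinal.{u}} (hx : x < θ) (h : LeastAbove D θ μ x) (h' : LeastAbove D θ' μ (J x)) :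
    J x = x := by
  rcases lt_trichotomy (J x) x with hlt | heq | hgt
  · exact absurd hlt (h.2.2 _ (hlt.trans hx) h'.1 h'.2.1)
  · exact heq
  · exact absurd hgt (h'.2.2 _ (hgt.trans (hJθ x hx)) h.1 h.2.1)

theorem limit_or_exists_fixed (hJθ : ∀ a < θ, J a < θ') {D : Set Ordinal.{u}}
    (hD : ∀ μ x, x < θ → LeastAbove D θ μ x → LeastAbove D θ' (J μ) (J x))
    {κ d : Ordinal.{u}} (hκ : ∀ x < κ, J x = x) (hκJ : κ < J κ) (hd : d ∈ D) (hκd : κ ≤ d)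
    (hdθ : d < θ) :
    (∀ μ < κ, ∃ x ∈ D, μ < x ∧ x < κ) ∨ ∃ ξ ∈ D, κ < ξ ∧ ξ ≤ d ∧ J ξ = ξ := by
  by_contra! h
  obtain ⟨⟨μ, hμ, hno⟩, hfix⟩ := h
  have hne : {x | x ∈ D ∧ μ < x}.Nonempty := ⟨d, hd, hμ.trans_le hκd⟩
  obtain ⟨hξD, hξμ⟩ := csInf_mem hne
  set ξ := sInf {x | x ∈ D ∧ μ < x}
  have hξd : ξ ≤ d := csInf_le' ⟨hd, hμ.trans_le hκd⟩
  have hleast : LeastAbove D θ μ ξ := ⟨hξD, hξμ, fun y _ hy hμy => not_lt.2 (csInf_le' ⟨hy, hμy⟩)⟩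
  have hξθ := hξd.trans_lt hdθ
  have hfixed : J ξ = ξ :=
    apply_eq_of_leastAbove hJθ hξθ hleast (by simpa only [hκ μ hμ] using hD μ ξ hξθ hleast)
  rcases (hno ξ hξD hξμ).lt_or_eq with hlt | heq
  · exact hfix ξ hξD hlt hξd hfixed
  · exact hκJ.ne' (heq ▸ hfixed)

/-- A ladder system excludes fixed points above the critical point of an ordinal embedding that
respects it. -/
theorem not_fixed_of_ladder {S : Ordinal.{u} → Set Ordinal.{u}}
    (hJ : ∀ a b, a < b → b < θ → J a < J b) (hJθ : ∀ a < θ, J a < θ')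
    (hS : ∀ a < θ, ∀ b ∈ S a, J b ∈ S (J a))
    (hSleast : ∀ l < θ, ∀ μ x, x < θ → LeastAbove (S l) θ μ x →
      LeastAbove (S (J l)) θ' (J μ) (J x))
    (hSlt : ∀ l, ∀ x ∈ S l, x < l)
    (hSfin : ∀ l, ∀ μ < l, (S l ∩ Set.Iio μ).Finite)
    (hScof : ∀ l (s : ℕ → Ordinal.{u}), StrictMono s → (∀ n, s n < l) →
      (∀ μ < l, ∃ n, μ < s n) → ∀ μ < l, ∃ x ∈ S l, μ < x)
    {κ ξ : Ordinal.{u}} (hκ : ∀ x < κ, J x = x) (hκ0 : 0 < κ) (hκJ : κ < J κ) (hκξ : κ < ξ)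
    (hξ : ξ < θ) : J ξ ≠ ξ := by
  intro hfix
  have hbelow : ∀ z, κ < z → z < θ → J z = z → ∀ n, J^[n] κ < z := by
    intro z hκz hz hJz n
    induction n with
    | zero => exact hκz
    | succ n ih =>
      rw [Function.iterate_succ_apply']
      exact (hJ _ _ ih hz).trans_eq hJz
  have hstep : ∀ n, J^[n] κ < J^[n + 1] κ := by
    intro n
    induction n with
    | zero => exact hκJ
    | succ n ih =>
      rw [Function.iterate_succ_apply', Function.iterate_succ_apply' J (n + 1)]
      exact hJ _ _ ih ((hbelow ξ hκξ hξ hfix _).trans hξ)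
  have hne : {x | ∀ n, J^[n] κ < x}.Nonempty := ⟨ξ, hbelow ξ hκξ hξ hfix⟩
  have hlt := csInf_mem hne
  set l := sInf {x | ∀ n, J^[n] κ < x} with hl
  have hlξ : l ≤ ξ := csInf_le' (hbelow ξ hκξ hξ hfix)
  have hlθ := hlξ.trans_lt hξ
  have hcof : ∀ μ < l, ∃ n, μ < J^[n] κ := by
    intro μ hμ
    by_contra! h
    exact hμ.not_ge (csInf_le' fun n => (hstep n).trans_le (h (n + 1)))
  have hSl := hScof l (fun n => J^[n] κ) (strictMono_nat_of_lt_succ hstep) hlt hcof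
  have hκl : κ < l := hlt 0
  have hinf : ¬(S l ∩ Set.Iio l).Finite :=
    not_finite_of_forall_exists_lt (hκ0.trans hκl)
      fun μ hμ => (hSl μ hμ).imp fun x hx => ⟨hx.1, hx.2, hSlt l x hx.1⟩
  have hJl : J l = l := by
    by_contra hJl
    have hlJ := (le_apply_of_strictMono_below hJ hlθ).lt_of_ne' hJl
    refine hinf (Set.Finite.of_finite_image ((hSfin (J l) l hlJ).subset ?_) (f := J) ?_)
    · rintro _ ⟨b, ⟨hb, hbl⟩, rfl⟩
      obtain ⟨n, hn⟩ := hcof b hbl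
      refine ⟨hS l hlθ b hb, lt_trans ?_ (hlt (n + 1))⟩
      rw [Function.iterate_succ_apply']
      exact hJ _ _ hn ((hlt n).trans hlθ)
    · intro a ha b hb hab
      rcases lt_trichotomy a b with h | h | h
      · exact absurd hab (hJ _ _ h (hb.2.trans hlθ)).ne
      · exact h
      · exact absurd hab (hJ _ _ h (ha.2.trans hlθ)).ne'
  obtain ⟨d, hd, hκd⟩ := hSl κ hκl
  have hdl := hSlt l d hd
  rcases limit_or_exists_fixed hJθ (D := S l)
    (fun μ x hx h => by simpa only [hJl] using hSleast l hlθ μ x hx h) hκ hκJ hd hκd.le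
    (hdl.trans hlθ) with h | ⟨z, hz, hκz, hzd, hJz⟩
  · exact not_finite_of_forall_exists_lt hκ0 h (hSfin l κ hκl)
  · have hzl := hzd.trans_lt hdl
    obtain ⟨n, hn⟩ := hcof z hzl
    exact hn.not_gt (hbelow z hκz (hzl.trans hlθ) hJz n)

theorem exists_critical_point {S : Ordinal.{u} → Set Ordinal.{u}} {C : Set Ordinal.{u}}
    (hJ : ∀ a b, a < b → b < θ → J a < J b) (hJθ : ∀ a < θ, J a < θ') (hJ0 : J 0 = 0)
    (hS : ∀ a < θ, ∀ b ∈ S a, J b ∈ S (J a))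
    (hSleast : ∀ l < θ, ∀ μ x, x < θ → LeastAbove (S l) θ μ x →
      LeastAbove (S (J l)) θ' (J μ) (J x))
    (hCleast : ∀ μ x, x < θ → LeastAbove C θ μ x → LeastAbove C θ' (J μ) (J x))
    (hSlt : ∀ l, ∀ x ∈ S l, x < l)
    (hSfin : ∀ l, ∀ μ < l, (S l ∩ Set.Iio μ).Finite)
    (hScof : ∀ l (s : ℕ → Ordinal.{u}), StrictMono s → (∀ n, s n < l) →
      (∀ μ < l, ∃ n, μ < s n) → ∀ μ < l, ∃ x ∈ S l, μ < x)
    {γ : Ordinal.{u}} (hγ : γ < θ) (hγC : γ ∈ C) (hγJ : J γ ≠ γ) :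
    ∃ κ ≤ γ, 0 < κ ∧ (∀ x < κ, J x = x) ∧ κ < J κ ∧ ∀ μ < κ, ∃ x ∈ C, μ < x ∧ x < κ := by
  have hne : {x | J x ≠ x}.Nonempty := ⟨γ, hγJ⟩
  have hκne := csInf_mem hne
  have hmin : ∀ x < sInf {x | J x ≠ x}, J x = x := fun x hx => not_not.1 (notMem_of_lt_csInf' hx)
  have hκγ : sInf {x | J x ≠ x} ≤ γ := csInf_le' hγJ
  set κ := sInf {x | J x ≠ x}
  have hκJ := (le_apply_of_strictMono_below hJ (hκγ.trans_lt hγ)).lt_of_ne' hκne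
  have hκ0 : 0 < κ := by
    rw [pos_iff_ne_zero]
    intro h
    exact hκne (by rw [h, hJ0])
  refine ⟨κ, hκγ, hκ0, hmin, hκJ, ?_⟩
  rcases limit_or_exists_fixed hJθ hCleast hmin hκJ hγC hκγ hγ with h | ⟨ξ, -, hκξ, hξγ, hξ⟩
  · exact h
  · exact absurd hξ (not_fixed_of_ladder hJ hJθ hS hSleast hSlt hSfin hScof hmin hκ0 hκJ hκξ
      (hξγ.trans_lt hγ))

end OrdinalEmbedding

section Formulas

variable {α : Type*} {n : ℕ}

/-- The symbol `ε`. -/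
def epsSym : LStd.Relations 2 := LStdRel.eps

/-- The symbol `R`. -/
def rSym : LStd.Relations 1 := LStdRel.r

/-- The atomic formula `ε s t`. -/
def epsF (s t : LStd.Term (α ⊕ Fin n)) : LStd.BoundedFormula α n :=
  epsSym.boundedFormula₂ s t

/-- The atomic formula `R s`. -/
def rF (s : LStd.Term (α ⊕ Fin n)) : LStd.BoundedFormula α n :=
  rSym.boundedFormula₁ s

/-- The formula defining membership from the coded binary relation. -/
def memF (s t : LStd.Term (α ⊕ Fin n)) : LStd.BoundedFormula α n :=
  epsF s t ⊓ (∼(s =' t) ⊓ ∼(epsF t s ⊓ (rF s ⊓ ∼(rF t))))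

/-- The formula defining the ladder relation from the coded binary relation. -/
def ladderF (s t : LStd.Term (α ⊕ Fin n)) : LStd.BoundedFormula α n :=
  epsF s t ⊓ (∼(s =' t) ⊓ ∼(memF s t))

/-- The formula stating that its free variable is an ordinal. -/
def ordF : LStd.Formula (Fin 1) :=
  ∀' ∀' (memF (&0) (.var (.inl 0)) ⟹ (memF (&1) (&0) ⟹
    (memF (&1) (.var (.inl 0)) ⊓ ∀' (memF (&2) (&1) ⟹ memF (&2) (&0)))))

/-- The formula stating that its free variable is empty. -/
def emptyF : LStd.Formula (Fin 1) :=
  ∀' ∼(memF (&0) (.var (.inl 0)))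

/-- The formula stating that variable 2 is the least point of the ladder at variable 0 above
variable 1. -/
def leastLadderF : LStd.Formula (Fin 3) :=
  ladderF (.var (.inl 0)) (.var (.inl 2)) ⊓ (memF (.var (.inl 1)) (.var (.inl 2)) ⊓
    ∀' (ladderF (.var (.inl 0)) (&0) ⟹ (memF (.var (.inl 1)) (&0) ⟹
      ∼(memF (&0) (.var (.inl 2))))))

/-- The formula stating that variable 2 is the least point above variable 1 whose ladder contains
variable 0. -/
def leastMarkedF : LStd.Formula (Fin 3) :=
  ladderF (.var (.inl 2)) (.var (.inl 0)) ⊓ (memF (.var (.inl 1)) (.var (.inl 2)) ⊓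
    ∀' (ladderF (&0) (.var (.inl 0)) ⟹ (memF (.var (.inl 1)) (&0) ⟹
      ∼(memF (&0) (.var (.inl 2))))))

/-- The formula stating that variable 1 is the greatest point whose ladder contains variable 0. -/
def maxMarkedF : LStd.Formula (Fin 2) :=
  ladderF (.var (.inl 1)) (.var (.inl 0)) ⊓
    ∀' (ladderF (&0) (.var (.inl 0)) ⟹ ∼(memF (.var (.inl 1)) (&0)))

/-- Add a dummy free variable to a term. -/
def liftT (t : LStd.Term (α ⊕ Fin n)) : LStd.Term ((α ⊕ Unit) ⊕ Fin n) :=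
  t.relabel (Sum.map Sum.inl id)

/-- The relativization of an atomic formula: `ε` becomes membership, and `R` becomes the diagonal
of the coded binary relation. -/
def atomF : ∀ {l : ℕ}, LStdRel l → (Fin l → LStd.Term (α ⊕ Fin n)) →
    LStd.BoundedFormula (α ⊕ Unit) n
  | _, .eps, ts => memF (liftT (ts 0)) (liftT (ts 1))
  | _, .r, ts => epsF (liftT (ts 0)) (liftT (ts 0))

/-- The relativization of a formula to the elements of a new free variable. -/
def relF : ∀ {n : ℕ}, LStd.BoundedFormula α n → LStd.BoundedFormula (α ⊕ Unit) n
  | _, .falsum => .falsum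
  | _, .equal s t => liftT s =' liftT t
  | _, .rel R ts => atomF R ts
  | _, .imp f g => relF f ⟹ relF g
  | n, .all f => ∀' (memF (.var (.inr (Fin.last n))) (.var (.inl (.inr ()))) ⟹ relF f)

end Formulas

/-- The relation on sets induced by a ladder system on the ordinals. -/
def Ladder (S : Ordinal.{u} → Set Ordinal.{u}) (x y : ZFSet.{u}) : Prop :=
  ∃ a b : Ordinal.{u}, x = a.toZFSet ∧ y = b.toZFSet ∧ b ∈ S a

/-- The class of limit ordinals and of those stages of the cumulative hierarchy that are not
ordinals. -/
def marks : Set ZFSet.{u} :=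
  {x | (∃ a : Ordinal.{u}, IsSuccLimit a ∧ x = a.toZFSet) ∨
    ∃ a : Ordinal.{u}, x = V_ a ∧ ¬x.IsOrdinal}

/-- The binary relation coding membership, the class `A` and a ladder system. -/
def codeRel (A : Set ZFSet.{u}) (S : Ordinal.{u} → Set Ordinal.{u}) (x y : ZFSet.{u}) : Prop :=
  x ∈ y ∨ (x = y ∧ x ∈ A) ∨ Ladder S x y

/-- A ladder system whose ladders consist of nonlimit ordinals and sit at limit ordinals. -/
structure IsLadderSystem (S : Ordinal.{u} → Set Ordinal.{u}) : Prop where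
  lt : ∀ a, ∀ b ∈ S a, b < a
  isSuccLimit : ∀ a, ∀ b ∈ S a, IsSuccLimit a
  not_isSuccLimit : ∀ a, ∀ b ∈ S a, ¬IsSuccLimit b

/-- An `L_std`-structure on `V_ θ` whose relations are the coded ones. -/
class IsCoded (A : Set ZFSet.{u}) (S : Ordinal.{u} → Set Ordinal.{u}) (θ : Ordinal.{u})
    [LStd.Structure ↥(V_ θ).toSet] : Prop where
  eps_iff : ∀ x y : ↥(V_ θ).toSet,
    Structure.RelMap epsSym ![x, y] ↔ codeRel A S x.1 y.1
  r_iff : ∀ x : ↥(V_ θ).toSet, Structure.RelMap rSym ![x] ↔ x.1 ∈ marks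

theorem toZFSet_mem_marks {a : Ordinal.{u}} : a.toZFSet ∈ marks ↔ IsSuccLimit a := by
  constructor
  · rintro (⟨b, hb, h⟩ | ⟨b, -, h⟩)
    · rwa [Ordinal.toZFSet_injective h]
    · exact absurd (isOrdinal_toZFSet a) h
  · exact fun h => .inl ⟨a, h, rfl⟩

section Codes

variable {A : Set ZFSet.{u}} {S : Ordinal.{u} → Set Ordinal.{u}} (hS : IsLadderSystem S)
include hS

theorem Ladder.mem {x y : ZFSet.{u}} (h : Ladder S x y) : y ∈ x := by
  obtain ⟨a, b, rfl, rfl, h⟩ := h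
  exact Ordinal.toZFSet_mem_toZFSet_iff.2 (hS.lt a b h)

theorem mem_iff_codeRel {x y : ZFSet.{u}} : x ∈ y ↔
    codeRel A S x y ∧ x ≠ y ∧ ¬(codeRel A S y x ∧ x ∈ marks ∧ y ∉ marks) := by
  constructor
  · intro h
    refine ⟨.inl h, ?_, ?_⟩
    · rintro rfl
      exact mem_irrefl _ h
    · rintro ⟨h' | ⟨rfl, -⟩ | h', -, hy⟩
      · exact mem_asymm h h'
      · exact mem_irrefl _ h
      · obtain ⟨a, b, rfl, rfl, hb⟩ := h'
        exact hy (toZFSet_mem_marks.2 (hS.isSuccLimit a b hb))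
  · rintro ⟨h | ⟨h, -⟩ | h, hne, hno⟩
    · exact h
    · exact absurd h hne
    · refine absurd ⟨.inl (h.mem hS), ?_⟩ hno
      obtain ⟨a, b, rfl, rfl, hb⟩ := h
      rw [toZFSet_mem_marks, toZFSet_mem_marks]
      exact ⟨hS.isSuccLimit a b hb, hS.not_isSuccLimit a b hb⟩

theorem ladder_iff_codeRel {x y : ZFSet.{u}} : Ladder S x y ↔
    codeRel A S x y ∧ x ≠ y ∧ x ∉ y := by
  constructor
  · intro h
    refine ⟨.inr (.inr h), ?_, mem_asymm (h.mem hS)⟩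
    rintro rfl
    exact mem_irrefl _ (h.mem hS)
  · rintro ⟨h | ⟨h, -⟩ | h, hne, hno⟩
    · exact absurd h hno
    · exact absurd h hne
    · exact h

theorem codeRel_self {x : ZFSet.{u}} : codeRel A S x x ↔ x ∈ A := by
  constructor
  · rintro (h | h | h)
    · exact absurd h (mem_irrefl x)
    · exact h.2
    · exact absurd (h.mem hS) (mem_irrefl x)
  · exact fun h => .inr (.inl ⟨rfl, h⟩)

variable {α : Type*} {n : ℕ} {θ : Ordinal.{u}} [LStd.Structure ↥(V_ θ).toSet]

section

omit hS

variable (A S) [IsCoded A S θ]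
include A S

theorem realize_epsF {s t : LStd.Term (α ⊕ Fin n)} {v : α → ↥(V_ θ).toSet}
    {xs : Fin n → ↥(V_ θ).toSet} : (epsF s t).Realize v xs ↔
      codeRel A S (s.realize (Sum.elim v xs)).1 (t.realize (Sum.elim v xs)).1 := by
  rw [epsF, BoundedFormula.realize_rel₂, IsCoded.eps_iff (A := A) (S := S)]

theorem realize_rF {s : LStd.Term (α ⊕ Fin n)} {v : α → ↥(V_ θ).toSet}
    {xs : Fin n → ↥(V_ θ).toSet} : (rF s).Realize v xs ↔
      (s.realize (Sum.elim v xs)).1 ∈ marks := by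
  rw [rF, BoundedFormula.realize_rel₁, IsCoded.r_iff A S]

end

variable (A) [IsCoded A S θ]
include A

theorem realize_memF {s t : LStd.Term (α ⊕ Fin n)} {v : α → ↥(V_ θ).toSet}
    {xs : Fin n → ↥(V_ θ).toSet} : (memF s t).Realize v xs ↔
      (s.realize (Sum.elim v xs)).1 ∈ (t.realize (Sum.elim v xs)).1 := by
  simp only [memF, BoundedFormula.realize_inf, BoundedFormula.realize_not,
    BoundedFormula.realize_bdEqual, realize_epsF A S, realize_rF A S]
  rw [mem_iff_codeRel hS (A := A), ne_eq, Subtype.ext_iff]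

theorem realize_ladderF {s t : LStd.Term (α ⊕ Fin n)} {v : α → ↥(V_ θ).toSet}
    {xs : Fin n → ↥(V_ θ).toSet} : (ladderF s t).Realize v xs ↔
      Ladder S (s.realize (Sum.elim v xs)).1 (t.realize (Sum.elim v xs)).1 := by
  simp only [ladderF, BoundedFormula.realize_inf, BoundedFormula.realize_not,
    BoundedFormula.realize_bdEqual, realize_epsF A S, realize_memF A hS]
  rw [ladder_iff_codeRel hS (A := A), ne_eq, Subtype.ext_iff]

theorem realize_emptyF {x : ↥(V_ θ).toSet} : emptyF.Realize ![x] ↔ x.1 = ∅ := by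
  simp only [emptyF, Formula.Realize, BoundedFormula.realize_all, BoundedFormula.realize_not,
    realize_memF A hS]
  simp [Fin.snoc, eq_empty]
  exact ⟨fun h y hy => h y ((isTransitive_vonNeumann θ).mem_trans hy x.2) hy, fun h y _ => h y⟩

theorem realize_ordF {x : ↥(V_ θ).toSet} : ordF.Realize ![x] ↔ x.1.IsOrdinal := by
  simp only [ordF, Formula.Realize, BoundedFormula.realize_all, BoundedFormula.realize_imp,
    BoundedFormula.realize_inf, realize_memF A hS]
  simp [Fin.snoc]
  have htr {a b : ZFSet.{u}} (ha : a ∈ b) (hb : b ∈ V_ θ) : a ∈ V_ θ :=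
    (isTransitive_vonNeumann θ).mem_trans ha hb
  constructor
  · intro h
    refine isOrdinal_iff_forall_mem_isTransitive.2 ⟨fun a ha b hb => ?_, fun a ha b hb c hc => ?_⟩
    · exact (h a (htr ha x.2) b (htr hb (htr ha x.2)) ha hb).1
    · exact (h a (htr ha x.2) b (htr hb (htr ha x.2)) ha hb).2 c (htr hc (htr hb (htr ha x.2))) hc
  · intro h a _ b _ ha hb
    exact ⟨h.mem_trans hb ha, fun c _ hc => (h.mem ha).mem_trans hc hb⟩

theorem realize_leastLadderF {l m x : ↥(V_ θ).toSet} : leastLadderF.Realize ![l, m, x] ↔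
    Ladder S l.1 x.1 ∧ m.1 ∈ x.1 ∧
      ∀ y : ↥(V_ θ).toSet, Ladder S l.1 y.1 → m.1 ∈ y.1 → y.1 ∉ x.1 := by
  simp only [leastLadderF, Formula.Realize, BoundedFormula.realize_all, BoundedFormula.realize_not,
    BoundedFormula.realize_imp, BoundedFormula.realize_inf, realize_memF A hS,
    realize_ladderF A hS]
  rfl

theorem realize_leastMarkedF {z m x : ↥(V_ θ).toSet} : leastMarkedF.Realize ![z, m, x] ↔
    Ladder S x.1 z.1 ∧ m.1 ∈ x.1 ∧
      ∀ y : ↥(V_ θ).toSet, Ladder S y.1 z.1 → m.1 ∈ y.1 → y.1 ∉ x.1 := by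
  simp only [leastMarkedF, Formula.Realize, BoundedFormula.realize_all, BoundedFormula.realize_not,
    BoundedFormula.realize_imp, BoundedFormula.realize_inf, realize_memF A hS,
    realize_ladderF A hS]
  rfl

theorem realize_maxMarkedF {z x : ↥(V_ θ).toSet} : maxMarkedF.Realize ![z, x] ↔
    Ladder S x.1 z.1 ∧ ∀ y : ↥(V_ θ).toSet, Ladder S y.1 z.1 → x.1 ∉ y.1 := by
  simp only [maxMarkedF, Formula.Realize, BoundedFormula.realize_all, BoundedFormula.realize_not,
    BoundedFormula.realize_imp, BoundedFormula.realize_inf, realize_memF A hS,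
    realize_ladderF A hS]
  rfl

/-- The inclusion of `V_ η` into `V_ θ`. -/
def inclV {η θ : Ordinal.{u}} (h : η ≤ θ) (x : {x : ZFSet.{u} // x.rank < η}) :
    ↥(V_ θ).toSet :=
  ⟨x.1, mem_vonNeumann.2 (x.2.trans_le h)⟩

/-- The set `V_ η` as an element of `V_ θ`. -/
noncomputable def stageV {η θ : Ordinal.{u}} (h : η < θ) : ↥(V_ θ).toSet :=
  ⟨V_ η, vonNeumann_mem_of_lt h⟩

omit [IsCoded A S θ] hS A [LStd.Structure ↥(V_ θ).toSet] in
theorem realize_liftT [LStd.Structure ↥(V_ θ).toSet] {η : Ordinal.{u}}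
    [LStd.Structure {x : ZFSet.{u} // x.rank < η}] (h : η < θ) (t : LStd.Term (α ⊕ Fin n))
    (w : α → {x : ZFSet.{u} // x.rank < η}) (xs : Fin n → {x : ZFSet.{u} // x.rank < η}) :
    (liftT t).realize (Sum.elim (Sum.elim (inclV h.le ∘ w) fun _ => stageV h) (inclV h.le ∘ xs)) =
      inclV h.le (t.realize (Sum.elim w xs)) := by
  rcases t with (a | a) | f
  · rfl
  · rfl
  · exact Empty.elim f

/-- The relativization of `φ` to `V_ η` expresses truth of `φ` in `⟨V_ η, ∈, A ∩ V_ η⟩`. -/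
theorem realize_relF {η : Ordinal.{u}} (h : η < θ) (φ : LStd.BoundedFormula α n)
    (w : α → {x : ZFSet.{u} // x.rank < η}) (xs : Fin n → {x : ZFSet.{u} // x.rank < η}) :
    (relF φ).Realize (Sum.elim (inclV h.le ∘ w) fun _ => stageV h) (inclV h.le ∘ xs) ↔
      @BoundedFormula.Realize LStd _ (VStructure η A) α n φ w xs := by
  let _ := VStructure η A
  induction φ with
  | falsum => exact Iff.rfl
  | equal s t =>
    rw [relF, BoundedFormula.realize_bdEqual, realize_liftT h, realize_liftT h]
    exact ⟨fun e => Subtype.ext (congrArg (fun z => z.1) e), fun e => congrArg _ e⟩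
  | rel R ts =>
    cases R with
    | eps =>
      change (memF _ _).Realize _ _ ↔ _
      rw [realize_memF A hS, realize_liftT h, realize_liftT h]
      rfl
    | r =>
      change (epsF _ _).Realize _ _ ↔ _
      rw [realize_epsF A S, realize_liftT h, codeRel_self hS]
      rfl
  | imp f g hf hg =>
    exact imp_congr (hf _) (hg _)
  | all f hf =>
    rw [relF, BoundedFormula.realize_all, BoundedFormula.realize_all]
    constructor
    · intro H a
      refine (hf _).1 ?_
      rw [Fin.comp_snoc]
      refine (BoundedFormula.realize_imp.1 (H (inclV h.le a))) ?_
      rw [realize_memF A hS]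
      simpa [Fin.snoc, inclV, stageV, mem_vonNeumann] using a.2
    · intro H a
      rw [BoundedFormula.realize_imp, realize_memF A hS]
      intro ha
      have ha' : a.1.rank < η := by simpa [Fin.snoc, stageV, mem_vonNeumann] using ha
      have := (hf (Fin.snoc xs ⟨a.1, ha'⟩)).2 (H ⟨a.1, ha'⟩)
      rwa [Fin.comp_snoc] at this

end Codes

section Embedding

variable {A : Set ZFSet.{u}} {S : Ordinal.{u} → Set Ordinal.{u}} {θ θ' : Ordinal.{u}}
  [LStd.Structure ↥(V_ θ).toSet] [LStd.Structure ↥(V_ θ').toSet]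

theorem realize_map₁ (j : ↥(V_ θ).toSet ↪ₑ[LStd] ↥(V_ θ').toSet) (φ : LStd.Formula (Fin 1))
    (x : ↥(V_ θ).toSet) : φ.Realize ![j x] ↔ φ.Realize ![x] := by
  refine Iff.trans ?_ (j.map_formula φ ![x])
  exact iff_of_eq (congrArg _ (by funext i; fin_cases i; rfl))

theorem realize_map₂ (j : ↥(V_ θ).toSet ↪ₑ[LStd] ↥(V_ θ').toSet) (φ : LStd.Formula (Fin 2))
    (x y : ↥(V_ θ).toSet) : φ.Realize ![j x, j y] ↔ φ.Realize ![x, y] := by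
  refine Iff.trans ?_ (j.map_formula φ ![x, y])
  exact iff_of_eq (congrArg _ (by funext i; fin_cases i <;> rfl))

theorem realize_map₃ (j : ↥(V_ θ).toSet ↪ₑ[LStd] ↥(V_ θ').toSet) (φ : LStd.Formula (Fin 3))
    (x y z : ↥(V_ θ).toSet) : φ.Realize ![j x, j y, j z] ↔ φ.Realize ![x, y, z] := by
  refine Iff.trans ?_ (j.map_formula φ ![x, y, z])
  exact iff_of_eq (congrArg _ (by funext i; fin_cases i <;> rfl))

variable [IsCoded A S θ] [IsCoded A S θ'] (hS : IsLadderSystem S)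
  (j : ↥(V_ θ).toSet ↪ₑ[LStd] ↥(V_ θ').toSet)

variable (A) in
include A hS in
theorem embed_mem {x y : ↥(V_ θ).toSet} : (j x).1 ∈ (j y).1 ↔ x.1 ∈ y.1 := by
  have h := realize_map₂ j (memF (.var (.inl 0)) (.var (.inl 1))) x y
  simp only [Formula.Realize, realize_memF A hS] at h
  exact h

variable (A) in
include A hS in
theorem embed_ladder {x y : ↥(V_ θ).toSet} :
    Ladder S (j x).1 (j y).1 ↔ Ladder S x.1 y.1 := by
  have h := realize_map₂ j (ladderF (.var (.inl 0)) (.var (.inl 1))) x y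
  simp only [Formula.Realize, realize_ladderF A hS] at h
  exact h

variable (A S) in
include A S in
theorem embed_marks {x : ↥(V_ θ).toSet} : (j x).1 ∈ marks ↔ x.1 ∈ marks := by
  have h := realize_map₁ j (rF (.var (.inl 0))) x
  simp only [Formula.Realize, realize_rF A S] at h
  exact h

variable (A) in
include A hS in
theorem embed_isOrdinal {x : ↥(V_ θ).toSet} : (j x).1.IsOrdinal ↔ x.1.IsOrdinal := by
  rw [← realize_ordF A hS, ← realize_ordF A hS, realize_map₁]

include hS in
/-- An embedding of coded structures restricts to an embedding
`⟨V_ η, ∈, A ∩ V_ η⟩ → ⟨V_ ζ, ∈, A ∩ V_ ζ⟩`. -/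
theorem etaExtendibleFor_of_embedding {κ η : ZFSet.{u}} (hη : η.rank < θ)
    (hηord : ¬(V_ η.rank).IsOrdinal) (hfix : ∀ x : ↥(V_ θ).toSet, x.1 ∈ κ → (j x).1 = x.1)
    (hmove : ∀ x : ↥(V_ θ).toSet, x.1 = κ → (j x).1 ≠ κ ∧ η ∈ (j x).1) :
    EtaExtendibleFor A κ η := by
  have hmark : (j (stageV hη)).1 ∈ marks := (embed_marks A S j).2 (.inr ⟨_, rfl, hηord⟩)
  have hnord : ¬(j (stageV hη)).1.IsOrdinal := fun h => hηord ((embed_isOrdinal A hS j).1 h)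
  obtain ⟨a, -, ha⟩ | ⟨ζ, hζ, -⟩ := hmark
  · exact absurd (ha ▸ isOrdinal_toZFSet a) hnord
  refine ⟨ζ.toZFSet, isOrdinal_toZFSet ζ, ?_⟩
  rw [← Ordinal.rank_toZFSet ζ] at hζ
  set ζ' := ζ.toZFSet
  have hζθ : ζ'.rank < θ' := by
    rw [← vonNeumann_mem_vonNeumann_iff, ← hζ]
    exact (j (stageV hη)).2
  have hstage : j (stageV hη) = stageV hζθ := Subtype.ext hζ
  let k : {x : ZFSet.{u} // x.rank < η.rank} → {x : ZFSet.{u} // x.rank < ζ'.rank} := fun x =>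
    ⟨(j (inclV hη.le x)).1, by
      rw [← mem_vonNeumann, ← hζ, embed_mem A hS]
      exact mem_vonNeumann.2 x.2⟩
  have hk : ∀ x, inclV hζθ.le (k x) = j (inclV hη.le x) := fun _ => rfl
  let _ := VStructure η.rank A
  let _ := VStructure ζ'.rank A
  refine ⟨⟨k, fun n φ x => ?_⟩, fun β hβ hβκ => hfix (inclV hη.le ⟨β, hβ⟩) hβκ,
    fun hκ => hmove (inclV hη.le ⟨κ, hκ⟩) rfl⟩
  have h := j.map_boundedFormula (relF φ)
    (Sum.elim (inclV hη.le ∘ x) fun _ => stageV hη) (inclV hη.le ∘ default)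
  rw [realize_relF A hS hη φ x default] at h
  refine Iff.trans ?_ h
  rw [Formula.Realize]
  refine (realize_relF A hS hζθ φ (k ∘ x) default).symm.trans ?_
  rw [Sum.comp_elim, iff_eq_eq]
  congr 1
  · funext i
    rcases i with i | i
    · rfl
    · exact hstage.symm
  · funext i
    exact i.elim0

/-- An ordinal below `θ` as an element of `V_ θ`. -/
noncomputable def ordV {a θ : Ordinal.{u}} (h : a < θ) : ↥(V_ θ).toSet :=
  ⟨a.toZFSet, mem_vonNeumann.2 (by rwa [Ordinal.rank_toZFSet])⟩

open Classical in
/-- The action of an embedding on ordinals. -/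
noncomputable def ordMap (a : Ordinal.{u}) : Ordinal.{u} :=
  if h : a < θ then (j (ordV h)).1.rank else 0

variable (A) in
include A hS in
theorem embed_ordV {a : Ordinal.{u}} (h : a < θ) : (j (ordV h)).1 = (ordMap j a).toZFSet := by
  rw [ordMap, dif_pos h]
  exact (((embed_isOrdinal A hS j).2 (isOrdinal_toZFSet a)).toZFSet_rank_eq).symm

omit [LStd.Structure ↥(V_ θ').toSet] [IsCoded A S θ] [IsCoded A S θ']
  [LStd.Structure ↥(V_ θ).toSet] in
theorem ladder_toZFSet {a b : Ordinal.{u}} : Ladder S a.toZFSet b.toZFSet ↔ b ∈ S a := by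
  constructor
  · rintro ⟨a', b', ha, hb, h⟩
    rwa [Ordinal.toZFSet_injective ha, Ordinal.toZFSet_injective hb]
  · exact fun h => ⟨a, b, rfl, rfl, h⟩

theorem ordMap_lt (a : Ordinal.{u}) (h : a < θ) : ordMap j a < θ' := by
  rw [ordMap, dif_pos h]
  exact mem_vonNeumann.1 (j (ordV h)).2

variable (A) in
include A hS in
theorem ordMap_lt_ordMap (a b : Ordinal.{u}) (hab : a < b) (hb : b < θ) :
    ordMap j a < ordMap j b := by
  have h := (embed_mem A hS j (x := ordV (hab.trans hb)) (y := ordV hb)).2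
    (Ordinal.toZFSet_mem_toZFSet_iff.2 hab)
  rwa [embed_ordV A hS, embed_ordV A hS, Ordinal.toZFSet_mem_toZFSet_iff] at h

variable (A) in
include A hS in
theorem ordMap_zero (hθ : 0 < θ) : ordMap j 0 = 0 := by
  have h := (realize_map₁ j emptyF (ordV hθ)).2 ((realize_emptyF A hS).2 Ordinal.toZFSet_zero)
  rw [realize_emptyF A hS, embed_ordV A hS, ← Ordinal.toZFSet_zero] at h
  exact Ordinal.toZFSet_injective h

variable (A) in
include A hS in
theorem ordMap_mem_ladder (a : Ordinal.{u}) (ha : a < θ) (b : Ordinal.{u}) (hb : b ∈ S a) :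
    ordMap j b ∈ S (ordMap j a) := by
  have h := (embed_ladder A hS j (x := ordV ha) (y := ordV ((hS.lt a b hb).trans ha))).2
    (ladder_toZFSet.2 hb)
  rwa [embed_ordV A hS, embed_ordV A hS, ladder_toZFSet] at h

variable (A) in
include A hS in
theorem realize_leastLadderF_ordV {l m x : Ordinal.{u}} (hl : l < θ) (hm : m < θ) (hx : x < θ) :
    leastLadderF.Realize ![ordV hl, ordV hm, ordV hx] ↔ LeastAbove (S l) θ m x := by
  rw [realize_leastLadderF A hS]
  refine and_congr ladder_toZFSet (and_congr Ordinal.toZFSet_mem_toZFSet_iff ⟨?_, ?_⟩)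
  · intro h y hy hyl hmy hyx
    exact h (ordV hy) (ladder_toZFSet.2 hyl) (Ordinal.toZFSet_mem_toZFSet_iff.2 hmy)
      (Ordinal.toZFSet_mem_toZFSet_iff.2 hyx)
  · rintro h ⟨_, hy⟩ ⟨a, y, ha, rfl, hyl⟩ hmy hyx
    rw [← Ordinal.toZFSet_injective ha] at hyl
    exact h y (by simpa using mem_vonNeumann.1 hy) hyl (Ordinal.toZFSet_mem_toZFSet_iff.1 hmy)
      (Ordinal.toZFSet_mem_toZFSet_iff.1 hyx)

variable (A) in
include A hS in
theorem realize_leastMarkedF_ordV {z m x : Ordinal.{u}} (hz : z < θ) (hm : m < θ) (hx : x < θ) :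
    leastMarkedF.Realize ![ordV hz, ordV hm, ordV hx] ↔ LeastAbove {a | z ∈ S a} θ m x := by
  rw [realize_leastMarkedF A hS]
  refine and_congr ladder_toZFSet (and_congr Ordinal.toZFSet_mem_toZFSet_iff ⟨?_, ?_⟩)
  · intro h y hy hyz hmy hyx
    exact h (ordV hy) (ladder_toZFSet.2 hyz) (Ordinal.toZFSet_mem_toZFSet_iff.2 hmy)
      (Ordinal.toZFSet_mem_toZFSet_iff.2 hyx)
  · rintro h ⟨_, hy⟩ ⟨y, a, rfl, ha, hyz⟩ hmy hyx
    rw [← Ordinal.toZFSet_injective ha] at hyz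
    exact h y (by simpa using mem_vonNeumann.1 hy) hyz (Ordinal.toZFSet_mem_toZFSet_iff.1 hmy)
      (Ordinal.toZFSet_mem_toZFSet_iff.1 hyx)

variable (A) in
include A hS in
theorem realize_maxMarkedF_ordV {z x : Ordinal.{u}} (hz : z < θ) (hx : x < θ) :
    maxMarkedF.Realize ![ordV hz, ordV hx] ↔ z ∈ S x ∧ ∀ y < θ, z ∈ S y → ¬x < y := by
  rw [realize_maxMarkedF A hS]
  refine and_congr ladder_toZFSet ⟨?_, ?_⟩
  · intro h y hy hyz hxy
    exact h (ordV hy) (ladder_toZFSet.2 hyz) (Ordinal.toZFSet_mem_toZFSet_iff.2 hxy)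
  · rintro h ⟨_, hy⟩ ⟨y, a, rfl, ha, hyz⟩ hxy
    rw [← Ordinal.toZFSet_injective ha] at hyz
    exact h y (by simpa using mem_vonNeumann.1 hy) hyz (Ordinal.toZFSet_mem_toZFSet_iff.1 hxy)

variable (A) in
include A hS in
theorem embed_ordV_eq {a : Ordinal.{u}} (h : a < θ) : j (ordV h) = ordV (ordMap_lt j a h) :=
  Subtype.ext (embed_ordV A hS j h)

variable (A) in
include A hS in
theorem ordMap_leastAbove_ladder (l : Ordinal.{u}) (hl : l < θ) (m x : Ordinal.{u}) (hx : x < θ)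
    (h : LeastAbove (S l) θ m x) :
    LeastAbove (S (ordMap j l)) θ' (ordMap j m) (ordMap j x) := by
  have hm := h.2.1.trans hx
  rw [← realize_leastLadderF_ordV A hS hl hm hx, ← realize_map₃ j, embed_ordV_eq A hS,
    embed_ordV_eq A hS, embed_ordV_eq A hS, realize_leastLadderF_ordV A hS] at h
  exact h

variable (A) in
include A hS in
theorem ordMap_leastAbove_marked (hθ : 0 < θ) (m x : Ordinal.{u}) (hx : x < θ)
    (h : LeastAbove {a | 0 ∈ S a} θ m x) :
    LeastAbove {a | 0 ∈ S a} θ' (ordMap j m) (ordMap j x) := by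
  have hm := h.2.1.trans hx
  rw [← realize_leastMarkedF_ordV A hS hθ hm hx, ← realize_map₃ j, embed_ordV_eq A hS,
    embed_ordV_eq A hS, embed_ordV_eq A hS, realize_leastMarkedF_ordV A hS,
    ordMap_zero A hS j hθ] at h
  exact h

variable (A) in
include A hS in
theorem ordMap_max_marked (hθ : 0 < θ) {x : Ordinal.{u}} (hx : x < θ)
    (h : 0 ∈ S x ∧ ∀ y < θ, 0 ∈ S y → ¬x < y) :
    0 ∈ S (ordMap j x) ∧ ∀ y < θ', 0 ∈ S y → ¬ordMap j x < y := by
  rw [← realize_maxMarkedF_ordV A hS hθ hx, ← realize_map₂ j, embed_ordV_eq A hS,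
    embed_ordV_eq A hS, realize_maxMarkedF_ordV A hS, ordMap_zero A hS j hθ] at h
  exact h

end Embedding

section Ladders

/-- A strictly increasing cofinal sequence of length `ω` in an ordinal. -/
structure IsCofinalSeq (l : Ordinal.{u}) (s : ℕ → Ordinal.{u}) : Prop where
  strictMono : StrictMono s
  lt : ∀ n, s n < l
  exists_lt : ∀ a < l, ∃ n, a < s n

/-- A ladder system that ladders every ordinal of cofinality `ω` and marks the elements of `C`
by `0`. -/
def ladders (C : Set Ordinal.{u}) (l : Ordinal.{u}) : Set Ordinal.{u} :=
  {b | (b = 0 ∧ l ∈ C) ∨ ∃ h : ∃ s, IsCofinalSeq l s, ∃ n, b = succ (h.choose n)}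

theorem IsCofinalSeq.isSuccLimit {l : Ordinal.{u}} {s : ℕ → Ordinal.{u}} (h : IsCofinalSeq l s) :
    IsSuccLimit l := by
  refine Ordinal.isSuccLimit_iff.2 ⟨(zero_le.trans_lt (h.lt 0)).ne',
    isSuccPrelimit_of_succ_lt fun a ha => ?_⟩
  obtain ⟨n, hn⟩ := h.exists_lt a ha
  exact (succ_le_of_lt hn).trans_lt (h.lt n)

variable {C : Set Ordinal.{u}}

theorem zero_mem_ladders {l : Ordinal.{u}} : 0 ∈ ladders C l ↔ l ∈ C := by
  constructor
  · rintro (⟨-, h⟩ | ⟨h, n, hn⟩)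
    · exact h
    · exact absurd hn (bot_lt_succ _).ne
  · exact fun h => .inl ⟨rfl, h⟩

theorem isLadderSystem_ladders (hC : ∀ a ∈ C, IsSuccLimit a) : IsLadderSystem (ladders C) where
  lt := by
    rintro l _ (⟨rfl, h⟩ | ⟨h, n, rfl⟩)
    · exact (hC l h).bot_lt
    · exact h.choose_spec.isSuccLimit.succ_lt (h.choose_spec.lt n)
  isSuccLimit := by
    rintro l _ (⟨rfl, h⟩ | ⟨h, n, rfl⟩)
    · exact hC l h
    · exact h.choose_spec.isSuccLimit
  not_isSuccLimit := by
    rintro l _ (⟨rfl, h⟩ | ⟨h, n, rfl⟩)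
    · exact fun h => h.ne_bot rfl
    · exact not_isSuccLimit_succ _

theorem finite_ladders_inter_Iio {l a : Ordinal.{u}} (ha : a < l) :
    (ladders C l ∩ Set.Iio a).Finite := by
  by_cases h : ∃ s, IsCofinalSeq l s
  · obtain ⟨N, hN⟩ := h.choose_spec.exists_lt a ha
    refine (((Set.finite_Iio N).image fun n => succ (h.choose n)).insert 0).subset ?_
    rintro _ ⟨⟨rfl, -⟩ | ⟨_, n, rfl⟩, hb⟩
    · exact .inl rfl
    · exact .inr ⟨n, h.choose_spec.strictMono.lt_iff_lt.1
        ((lt_succ _).trans ((Set.mem_Iio.1 hb).trans hN)), rfl⟩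
  · refine (Set.finite_singleton 0).subset ?_
    rintro _ ⟨⟨rfl, -⟩ | ⟨h', -⟩, -⟩
    · rfl
    · exact absurd h' h

theorem exists_mem_ladders_gt {l : Ordinal.{u}} {s : ℕ → Ordinal.{u}} (hs : IsCofinalSeq l s)
    {a : Ordinal.{u}} (ha : a < l) : ∃ x ∈ ladders C l, a < x := by
  have h : ∃ s, IsCofinalSeq l s := ⟨s, hs⟩
  obtain ⟨n, hn⟩ := h.choose_spec.exists_lt a ha
  exact ⟨succ (h.choose n), .inr ⟨h, n, rfl⟩, hn.trans (lt_succ _)⟩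

end Ladders

section ClosurePoints

variable {g : Ordinal.{u} → Ordinal.{u}}

/-- The limit ordinals closed under `g`. -/
def closurePoints (g : Ordinal.{u} → Ordinal.{u}) : Set Ordinal.{u} :=
  {c | IsSuccLimit c ∧ ∀ a < c, g a < c}

theorem exists_mem_closurePoints_gt (g : Ordinal.{u} → Ordinal.{u}) (b : Ordinal.{u}) :
    ∃ c ∈ closurePoints g, b < c := by
  let h : Ordinal.{u} → Ordinal.{u} := fun a =>
    max (succ a) (⨆ x : Set.Iio a, succ (g x))
  have hsucc (n : ℕ) : h (h^[n] (succ b)) ≤ Ordinal.nfp h (succ b) := by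
    rw [← Function.iterate_succ_apply' h]
    exact Ordinal.iterate_le_nfp h _ _
  have hb : b < Ordinal.nfp h (succ b) :=
    (lt_succ b).trans_le (Ordinal.iterate_le_nfp h (succ b) 0)
  refine ⟨Ordinal.nfp h (succ b), ⟨Ordinal.isSuccLimit_iff.2 ⟨(zero_le.trans_lt hb).ne',
    isSuccPrelimit_of_succ_lt fun a ha => ?_⟩, fun a ha => ?_⟩, hb⟩
  · obtain ⟨n, hn⟩ := Ordinal.lt_nfp_iff.1 ha
    exact (succ_le_of_lt hn).trans_lt (((lt_succ _).trans_le (le_max_left _ _)).trans_le (hsucc n))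
  · obtain ⟨n, hn⟩ := Ordinal.lt_nfp_iff.1 ha
    refine (lt_succ (g a)).trans_le (le_trans ?_ (hsucc n))
    exact (Ordinal.le_iSup (fun x : Set.Iio (h^[n] (succ b)) => succ (g x)) ⟨a, hn⟩).trans
      (le_max_right _ _)

theorem mem_closurePoints_of_forall_exists {c : Ordinal.{u}} (hc : 0 < c)
    (h : ∀ a < c, ∃ x ∈ closurePoints g, a < x ∧ x < c) : c ∈ closurePoints g := by
  refine ⟨Ordinal.isSuccLimit_iff.2 ⟨hc.ne', isSuccPrelimit_of_succ_lt fun a ha => ?_⟩,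
    fun a ha => ?_⟩
  · obtain ⟨x, -, hax, hxc⟩ := h a ha
    exact (succ_le_of_lt hax).trans_lt hxc
  · obtain ⟨x, hx, hax, hxc⟩ := h a ha
    exact (hx.2 a hax).trans hxc

theorem zfIsCardinal_of_mem_closurePoints (hg : ∀ a, (succ a.card).ord ≤ g a) {c : Ordinal.{u}}
    (hc : c ∈ closurePoints g) : ZFIsCardinal c.toZFSet := by
  refine ⟨isOrdinal_toZFSet c, fun b hb => ?_⟩
  obtain ⟨a, ha, rfl⟩ := Ordinal.mem_toZFSet_iff.1 hb
  have h : a.card < c.card := calc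
    a.card < succ a.card := lt_succ _
    _ = (succ a.card).ord.card := (Cardinal.card_ord _).symm
    _ ≤ c.card := Ordinal.card_le_card ((hg a).trans (hc.2 a ha).le)
  have key (o : Ordinal.{u}) :
      Cardinal.mk ↥o.toZFSet.toSet = Cardinal.lift.{u + 1, u} o.card :=
    (cardinalMk_coe_sort (x := o.toZFSet)).trans (congrArg _ (Ordinal.card_toZFSet o))
  rw [key, key, Cardinal.lift_lt]
  exact h

end ClosurePoints

section Coding

variable (A : Set ZFSet.{u}) (S : Ordinal.{u} → Set Ordinal.{u})

/-- The coded binary relation on `V_ θ`, as a set. -/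
noncomputable def relSet (θ : Ordinal.{u}) : ZFSet.{u} := pairSep (codeRel A S) (V_ θ) (V_ θ)

/-- The coded unary relation on `V_ θ`, as a set. -/
noncomputable def markSet (θ : Ordinal.{u}) : ZFSet.{u} := ZFSet.sep (· ∈ marks) (V_ θ)

/-- The code of the structure on `V_ θ`. -/
noncomputable def code (θ : Ordinal.{u}) : ZFSet.{u} :=
  (V_ θ).pair ((relSet A S θ).pair (markSet θ))

theorem isLStdCode_code (θ : Ordinal.{u}) : IsLStdCode (code A S θ) := by
  refine ⟨_, _, _, rfl, fun p hp => ?_, sep_subset⟩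
  obtain ⟨a, ha, b, hb, rfl, -⟩ := mem_pairSep.1 hp
  exact ⟨a, ha, b, hb, rfl⟩

theorem isCoded_codedStructure (θ : Ordinal.{u}) :
    @IsCoded A S θ (codedStructure (V_ θ) (relSet A S θ) (markSet θ)) := by
  let _ := codedStructure (V_ θ) (relSet A S θ) (markSet θ)
  refine ⟨fun x y => ?_, fun x => ?_⟩
  · change x.1.pair y.1 ∈ relSet A S θ ↔ _
    rw [relSet, mem_pairSep]
    constructor
    · rintro ⟨a, -, b, -, h, hab⟩
      obtain ⟨ha, hb⟩ := pair_inj.1 h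
      rwa [ha, hb]
    · exact fun h => ⟨x.1, x.2, y.1, y.2, rfl, h⟩
  · change x.1 ∈ markSet θ ↔ _
    rw [markSet, mem_sep]
    exact and_iff_right x.2

theorem lt_rank_code (θ : Ordinal.{u}) : θ < (code A S θ).rank := by
  have h₁ : ({V_ θ} : ZFSet.{u}) ∈ code A S θ := by simp [code, pair]
  have h₂ : V_ θ ∈ ({V_ θ} : ZFSet.{u}) := mem_singleton.2 rfl
  simpa using (rank_lt_of_mem h₂).trans (rank_lt_of_mem h₁)

theorem isProperClass_code {D : Set Ordinal.{u}} (hD : ∀ a, ∃ b ∈ D, a < b) :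
    IsProperClass (code A S '' D) := by
  rintro ⟨a, ha⟩
  obtain ⟨b, hb, hab⟩ := hD a.rank
  have h : code A S b ∈ a.toSet := ha ▸ Set.mem_image_of_mem _ hb
  exact (hab.trans (lt_rank_code A S b)).not_gt (rank_lt_of_mem h)

variable {A S} in
theorem exists_embedding_of_elemEmbeddable {θ θ' : Ordinal.{u}}
    (h : ElemEmbeddable (code A S θ) (code A S θ')) :
    letI := codedStructure (V_ θ) (relSet A S θ) (markSet θ)
    letI := codedStructure (V_ θ') (relSet A S θ') (markSet θ')
    Nonempty (↥(V_ θ).toSet ↪ₑ[LStd] ↥(V_ θ').toSet) := by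
  obtain ⟨M, E, R, N, E', R', h₁, h₂, j⟩ := h
  obtain ⟨rfl, hER⟩ := pair_inj.1 h₁
  obtain ⟨rfl, rfl⟩ := pair_inj.1 hER
  obtain ⟨rfl, hER'⟩ := pair_inj.1 h₂
  obtain ⟨rfl, rfl⟩ := pair_inj.1 hER'
  exact j

end Coding

theorem not_isOrdinal_vonNeumann {a : Ordinal.{u}} (ha : 2 < a) : ¬(V_ a).IsOrdinal := by
  intro h
  have hmem : ({{∅}} : ZFSet.{u}) ∈ V_ a := by
    rw [mem_vonNeumann, rank_singleton, rank_singleton, rank_empty]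
    simpa [one_add_one_eq_two] using ha
  have h₁ := (h.mem hmem).subset_of_mem (mem_singleton.2 rfl) (mem_singleton.2 rfl)
  have h₂ : (∅ : ZFSet.{u}) ∈ ({∅} : ZFSet.{u}) := mem_singleton.2 rfl
  rw [← mem_singleton.1 h₁] at h₂
  exact notMem_empty _ h₂

/-- If an embedding of coded structures moves a closure point of `g`, then some closure point `κ`
of `g` is extendible up to `g κ`. -/
theorem exists_etaExtendibleFor {A : Set ZFSet.{u}} {g : Ordinal.{u} → Ordinal.{u}}
    {θ θ' c : Ordinal.{u}} [LStd.Structure ↥(V_ θ).toSet] [LStd.Structure ↥(V_ θ').toSet]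
    [IsCoded A (ladders (closurePoints g)) θ] [IsCoded A (ladders (closurePoints g)) θ']
    (j : ↥(V_ θ).toSet ↪ₑ[LStd] ↥(V_ θ').toSet) (hθ : θ ∈ closurePoints g)
    (hcθ : c < θ) (hc : c ∈ closurePoints g) (hjc : ordMap j c ≠ c) :
    ∃ κ ∈ closurePoints g, ∀ η : ZFSet.{u}, η.IsOrdinal → κ.toZFSet ∈ η → η.rank ≤ g κ →
      EtaExtendibleFor A κ.toZFSet η := by
  have hS : IsLadderSystem (ladders (closurePoints g)) := isLadderSystem_ladders fun a ha => ha.1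
  have hθ0 : 0 < θ := hθ.1.bot_lt
  have h0 := ordMap_zero A hS j hθ0
  obtain ⟨κ, hκc, hκ0, hfix, hκj, hlim⟩ := exists_critical_point (J := ordMap j)
    (C := closurePoints g) (ordMap_lt_ordMap A hS j) (ordMap_lt j) h0 (ordMap_mem_ladder A hS j)
    (ordMap_leastAbove_ladder A hS j)
    (by simpa only [zero_mem_ladders, Set.ofPred_mem_eq] using ordMap_leastAbove_marked A hS j hθ0)
    hS.lt (fun _ _ => finite_ladders_inter_Iio)
    (fun _ _ hs hl hcof _ => exists_mem_ladders_gt ⟨hs, hl, hcof⟩) hcθ hc hjc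
  have hκθ := hκc.trans_lt hcθ
  have hκ : κ ∈ closurePoints g := mem_closurePoints_of_forall_exists hκ0 hlim
  have hjκ : ordMap j κ ∈ closurePoints g := by
    have h := ordMap_mem_ladder A hS j κ hκθ 0 (zero_mem_ladders.2 hκ)
    rwa [h0, zero_mem_ladders] at h
  refine ⟨κ, hκ, fun η hη hκη hηg => ?_⟩
  have hκη' : κ < η.rank := by simpa using rank_lt_of_mem hκη
  have hηκ : η.rank < ordMap j κ := hηg.trans_lt (hjκ.2 κ hκj)
  refine etaExtendibleFor_of_embedding hS j (hηg.trans_lt (hθ.2 κ hκθ))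
    (not_isOrdinal_vonNeumann ((Ordinal.natCast_lt_omega0 2).trans_le
      ((Ordinal.omega0_le_of_isSuccLimit hκ.1).trans hκη'.le))) ?_ ?_
  · rintro ⟨_, hx⟩ hxκ
    obtain ⟨a, ha, rfl⟩ := Ordinal.mem_toZFSet_iff.1 hxκ
    exact (embed_ordV A hS j (ha.trans hκθ)).trans (congrArg _ (hfix a ha))
  · rintro ⟨_, hx⟩ rfl
    have h : (j ⟨κ.toZFSet, hx⟩).1 = (ordMap j κ).toZFSet := embed_ordV A hS j hκθ
    rw [h]
    refine ⟨fun h => hκj.ne' (Ordinal.toZFSet_injective h), ?_⟩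
    rw [← hη.toZFSet_rank_eq]
    exact Ordinal.toZFSet_mem_toZFSet_iff.2 hηκ

/-- Under Vopěnka's Principle, every function `g` on the ordinals has a closure point `κ` that is
extendible up to `g κ`. -/
theorem exists_etaExtendibleFor_of_vopenkaPrinciple (hVP : VopenkaPrinciple.{u}) (A : Set ZFSet.{u})
    (g : Ordinal.{u} → Ordinal.{u}) :
    ∃ κ ∈ closurePoints g, ∀ η : ZFSet.{u}, η.IsOrdinal → κ.toZFSet ∈ η → η.rank ≤ g κ →
      EtaExtendibleFor A κ.toZFSet η := by
  have hS : IsLadderSystem (ladders (closurePoints g)) := isLadderSystem_ladders fun a ha => ha.1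
  let D : Set Ordinal.{u} := {θ | ∃ c, IsGreatest (closurePoints g ∩ Set.Iio θ) c ∧
    θ ∈ closurePoints g}
  have hD : ∀ a, ∃ b ∈ D, a < b := by
    intro a
    obtain ⟨c, hc, hac⟩ := exists_mem_closurePoints_gt g a
    have hne : {x | x ∈ closurePoints g ∧ c < x}.Nonempty := exists_mem_closurePoints_gt g c
    have hmem := csInf_mem hne
    refine ⟨sInf {x | x ∈ closurePoints g ∧ c < x}, ⟨c, ⟨⟨hc, hmem.2⟩, ?_⟩, hmem.1⟩,
      hac.trans hmem.2⟩
    rintro x ⟨hx, hxlt⟩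
    by_contra hcx
    exact notMem_of_lt_csInf' (Set.mem_Iio.1 hxlt) (show _ ∧ _ from ⟨hx, not_le.1 hcx⟩)
  obtain ⟨_, ⟨θ, ⟨c, hc, hθ⟩, rfl⟩, _, ⟨θ', ⟨c', hc', hθ'⟩, rfl⟩, hne, hj⟩ := hVP _
    (isProperClass_code A (ladders (closurePoints g)) hD)
    (Set.forall_mem_image.2 fun θ _ => isLStdCode_code A _ θ)
  let _ := codedStructure (V_ θ) (relSet A (ladders (closurePoints g)) θ) (markSet θ)
  let _ := codedStructure (V_ θ') (relSet A (ladders (closurePoints g)) θ') (markSet θ')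
  have _ := isCoded_codedStructure A (ladders (closurePoints g)) θ
  have _ := isCoded_codedStructure A (ladders (closurePoints g)) θ'
  obtain ⟨j⟩ := exists_embedding_of_elemEmbeddable hj
  refine exists_etaExtendibleFor j hθ hc.1.2 hc.1.1 fun h => hne ?_
  have hmax := ordMap_max_marked A hS j hθ.1.bot_lt hc.1.2 ⟨zero_mem_ladders.2 hc.1.1,
    fun y hy hyC hcy => hcy.not_ge (hc.2 ⟨zero_mem_ladders.1 hyC, hy⟩)⟩
  rw [h] at hmax
  have hcθ' : c < θ' := h ▸ ordMap_lt j c hc.1.2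
  rcases lt_trichotomy θ θ' with hlt | rfl | hlt
  · exact absurd hc.1.2 (hmax.2 θ hlt (zero_mem_ladders.2 hθ))
  · rfl
  · exact absurd (hc.2 ⟨hθ', hlt⟩) hcθ'.not_ge

end Vopenka

/-- Assuming Vopěnka's Principle, for every proper class `A` there is an `A`-extendible
cardinal. -/
theorem aExtendible_of_vopenkaPrinciple (hVP : VopenkaPrinciple.{u}) :
    ∀ A : Set ZFSet.{u}, IsProperClass A → ∃ α : ZFSet.{u}, AExtendible A α := by
  intro A _
  by_contra hno
  have h : ∀ a : Ordinal.{u}, ∃ η : ZFSet.{u}, ZFIsCardinal a.toZFSet →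
      η.IsOrdinal ∧ a.toZFSet ∈ η ∧ ¬EtaExtendibleFor A a.toZFSet η := by
    intro a
    by_contra hη
    push Not at hη
    exact hno ⟨a.toZFSet, (hη ∅).1, fun η => (hη η).2⟩
  choose e he using h
  obtain ⟨κ, hκ, hext⟩ := Vopenka.exists_etaExtendibleFor_of_vopenkaPrinciple hVP A
    fun a => max (Order.succ a.card).ord (e a).rank
  obtain ⟨hord, hmem, hnot⟩ :=
    he κ (Vopenka.zfIsCardinal_of_mem_closurePoints (fun _ => le_max_left _ _) hκ)
  exact hnot (hext _ hord hmem (le_max_right _ _))
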